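/- Let n ≥ 1 be an integer, 0 < q < 1, and let π have the Mallows distribution μ_{n,q}. Let s, t ∈ {1,…,n} and set U := {(x,y) ∈ {1,…,n}² : x < s or y < t}. Let g ⊆ U be any set with P[Γ_π ∩ U = g] > 0. Then: if g contains no point of the form (x,t) with x < s and no point of the form (s,y) with y < t, then P[π(s) = t | Γ_π ∩ U = g] = (1−q)/(1−q^{n−|g|}); otherwise P[π(s) = t | Γ_π ∩ U = g] = 0. (Here note that on the conditioning event |Γ_π ∩ U^c| = n − |g|.) -/

import Mathlib

open Finset
open scoped Classical BigOperators

noncomputable section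

/-- Number of inversions of a permutation of `Fin n` (0-indexed positions). -/
def invCount (n : ℕ) (π : Equiv.Perm (Fin n)) : ℕ :=
  ((Finset.univ : Finset (Fin n × Fin n)).filter
    (fun p => p.1 < p.2 ∧ π p.2 < π p.1)).card

/-- Normalizing constant of the Mallows distribution. -/
def mallowsZ (n : ℕ) (q : ℝ) : ℝ :=
  ∑ σ : Equiv.Perm (Fin n), q ^ invCount n σ

/-- Mallows probability of an individual permutation. -/
def mallowsP (n : ℕ) (q : ℝ) (π : Equiv.Perm (Fin n)) : ℝ :=
  q ^ invCount n π / mallowsZ n q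

/-- Expectation of a real-valued functional under the Mallows distribution. -/
def mExp (n : ℕ) (q : ℝ) (X : Equiv.Perm (Fin n) → ℝ) : ℝ :=
  ∑ π : Equiv.Perm (Fin n), mallowsP n q π * X π

/-- Probability of an event under the Mallows distribution. -/
def mProb (n : ℕ) (q : ℝ) (A : Equiv.Perm (Fin n) → Prop) : ℝ :=
  ∑ π : Equiv.Perm (Fin n), if A π then mallowsP n q π else 0

/-- Conditional probability of `A` given `B` under the Mallows distribution. -/
def mCondProb (n : ℕ) (q : ℝ) (A B : Equiv.Perm (Fin n) → Prop) : ℝ :=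
  mProb n q (fun π => A π ∧ B π) / mProb n q B

/-- The graph `Γ_π = {(s, π(s))}` of a permutation, as a subset of `Fin n × Fin n`. -/
def graphP (n : ℕ) (π : Equiv.Perm (Fin n)) : Finset (Fin n × Fin n) :=
  Finset.univ.filter (fun p => π p.1 = p.2)

theorem inv_step (n : ℕ) (π : Equiv.Perm (Fin n)) (s a b c : Fin n) (hsa : s < a)
    (hb : π s = b) (hc : π a = c) (hbc : b < c)
    (hbet : ∀ x, b < π x → π x < c → x < s) :
    invCount n (Equiv.swap b c * π) = invCount n π + 1 := by
  have hσ : ∀ x, (Equiv.swap b c * π) x = if x = s then c else if x = a then b else π x := by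
    intro x
    rw [Equiv.Perm.mul_apply]
    split_ifs with h h'
    · subst h; rw [hb]; simp
    · subst h'; rw [hc]; simp
    · apply Equiv.swap_apply_of_ne_of_ne
      · rw [← hb]; exact fun e => h (π.injective e)
      · rw [← hc]; exact fun e => h' (π.injective e)
  have hinjs : ∀ x, π x = b → x = s := fun x h => π.injective (h.trans hb.symm)
  have hinja : ∀ x, π x = c → x = a := fun x h => π.injective (h.trans hc.symm)
  set φ : Fin n × Fin n → Fin n × Fin n :=
    fun p => if p.1 < s then (p.1, if p.2 = s then a else if p.2 = a then s else p.2) else p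
    with hφ
  unfold invCount
  have hmem : (s, a) ∈ (Finset.univ : Finset (Fin n × Fin n)).filter
    (fun p => p.1 < p.2 ∧ (Equiv.swap b c * π) p.2 < (Equiv.swap b c * π) p.1) := by
    simp only [hσ, Finset.mem_filter, Finset.mem_univ, true_and]
    grind
  rw [← Finset.card_erase_add_one hmem]
  congr 1
  have hφφ : ∀ p, φ (φ p) = p := by
    rintro ⟨x, y⟩
    simp only [hφ]
    grind
  apply Finset.card_nbij' φ φ
  · rintro ⟨x, y⟩ h
    simp only [hσ, Finset.coe_erase, Finset.coe_filter, Finset.mem_univ, true_and,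
      Set.mem_sdiff, Set.mem_ofPred_eq, Set.mem_singleton_iff, Prod.mk.injEq] at h
    simp only [hφ, Finset.coe_filter, Finset.mem_univ, true_and, Set.mem_ofPred_eq]
    have h1 := hbet x
    have h2 := hbet y
    have h3 := hinjs x
    have h4 := hinjs y
    have h5 := hinja x
    have h6 := hinja y
    clear hφφ hbet hσ hmem hinjs hinja hφ φ
    by_cases k1 : x < s
    · simp only [k1, if_true]
      grind
    · simp only [k1, if_false]
      grind
  · rintro ⟨x, y⟩ h
    simp only [hσ, Finset.coe_erase, Finset.coe_filter, Finset.mem_univ, true_and,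
      Set.mem_sdiff, Set.mem_ofPred_eq, Set.mem_singleton_iff] at h ⊢
    simp only [hφ]
    have h1 := hbet x
    have h2 := hbet y
    have h3 := hinjs x
    have h4 := hinjs y
    have h5 := hinja x
    have h6 := hinja y
    clear hφφ hbet hσ hmem hinjs hinja hφ φ
    by_cases k1 : x < s
    · simp only [k1, if_true]
      grind
    · simp only [k1, if_false]
      grind
  · intro p _; exact hφφ p
  · intro p _; exact hφφ p

theorem sum_rank {n : ℕ} (q : ℝ) (B : Finset (Fin n)) :
    ∑ b ∈ B, q ^ (B.filter (· < b)).card = ∑ i ∈ Finset.range B.card, q ^ i := by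
  induction B using Finset.induction_on_max with
  | empty => simp
  | insert a B hlt ih =>
    have ha : a ∉ B := fun h => lt_irrefl _ (hlt a h)
    rw [Finset.sum_insert ha, Finset.card_insert_of_notMem ha, Finset.sum_range_succ, ← ih,
      add_comm]
    congr 1
    · apply Finset.sum_congr rfl
      intro b hb
      congr 2
      ext x
      have := hlt b hb
      simp only [Finset.mem_filter, Finset.mem_insert]
      grind
    · congr 2
      ext x
      have := hlt x
      simp only [Finset.mem_filter, Finset.mem_insert]
      grind

def evE (n : ℕ) (s t : Fin n) (g : Finset (Fin n × Fin n)) (π : Equiv.Perm (Fin n)) : Prop :=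
  graphP n π ∩ Finset.univ.filter (fun p : Fin n × Fin n => p.1 < s ∨ p.2 < t) = g

theorem evE_iff (n : ℕ) (s t : Fin n) (g : Finset (Fin n × Fin n))
    (hgU : ∀ p ∈ g, p.1 < s ∨ p.2 < t) (π : Equiv.Perm (Fin n)) :
    evE n s t g π ↔ ∀ x y, (x < s ∨ y < t) → (π x = y ↔ (x, y) ∈ g) := by
  unfold evE graphP
  rw [Finset.ext_iff]
  constructor
  · intro h x y hxy
    have := h (x, y)
    simp only [Finset.mem_inter, Finset.mem_filter, Finset.mem_univ, true_and] at this
    tauto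
  · rintro h ⟨x, y⟩
    have := h x y
    have := hgU (x, y)
    simp only [Finset.mem_inter, Finset.mem_filter, Finset.mem_univ, true_and]
    tauto

def setB (n : ℕ) (t : Fin n) (g : Finset (Fin n × Fin n)) : Finset (Fin n) :=
  Finset.univ.filter (fun y => t ≤ y ∧ ∀ x, (x, y) ∉ g)

def wt (n : ℕ) (q : ℝ) (s t : Fin n) (g : Finset (Fin n × Fin n)) (b : Fin n) : ℝ :=
  ∑ π : Equiv.Perm (Fin n), if π s = b ∧ evE n s t g π then q ^ invCount n π else 0

theorem evE_swap (n : ℕ) (s t : Fin n) (g : Finset (Fin n × Fin n))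
    (hgU : ∀ p ∈ g, p.1 < s ∨ p.2 < t) (π : Equiv.Perm (Fin n)) (b c : Fin n)
    (hb : b ∈ setB n t g) (hc : c ∈ setB n t g) (h : evE n s t g π) :
    evE n s t g (Equiv.swap b c * π) := by
  rw [evE_iff n s t g hgU] at h ⊢
  intro x y hxy
  simp only [setB, Finset.mem_filter, Finset.mem_univ, true_and] at hb hc
  have e : (Equiv.swap b c * π) x = y ↔ π x = Equiv.swap b c y := by
    rw [Equiv.Perm.mul_apply]
    constructor
    · rintro rfl; simp
    · intro h; rw [h]; simp
  rw [e]
  have h1 := h x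
  by_cases hyb : y = b
  · subst hyb
    rw [Equiv.swap_apply_left, h1 c (by left; grind)]
    simp [hb.2 x, hc.2 x]
  by_cases hyc : y = c
  · subst hyc
    rw [Equiv.swap_apply_right, h1 b (by left; grind)]
    simp [hb.2 x, hc.2 x]
  rw [Equiv.swap_apply_of_ne_of_ne hyb hyc]
  exact h1 y hxy

theorem mem_setB_iff (n : ℕ) (s t : Fin n) (g : Finset (Fin n × Fin n))
    (hgU : ∀ p ∈ g, p.1 < s ∨ p.2 < t) (π : Equiv.Perm (Fin n)) (h : evE n s t g π) (x : Fin n) :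
    π x ∈ setB n t g ↔ t ≤ π x ∧ s ≤ x := by
  rw [evE_iff n s t g hgU] at h
  simp only [setB, Finset.mem_filter, Finset.mem_univ, true_and]
  constructor
  · rintro ⟨h1, h2⟩
    refine ⟨h1, ?_⟩
    by_contra hx
    exact h2 x ((h x (π x) (Or.inl (not_le.mp hx))).1 rfl)
  · rintro ⟨h1, h2⟩
    refine ⟨h1, fun z hz => ?_⟩
    have hU := hgU _ hz
    have := (h z (π x) hU).2 hz
    have := π.injective this
    subst this
    rcases hU with hU | hU
    · exact absurd hU (not_lt.mpr h2)
    · exact absurd hU (not_lt.mpr h1)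

theorem wt_step (n : ℕ) (q : ℝ) (s t : Fin n) (g : Finset (Fin n × Fin n))
    (hgU : ∀ p ∈ g, p.1 < s ∨ p.2 < t) (b c : Fin n)
    (hb : b ∈ setB n t g) (hc : c ∈ setB n t g) (hbc : b < c)
    (hbet : ∀ y ∈ setB n t g, b < y → ¬ y < c) :
    wt n q s t g c = q * wt n q s t g b := by
  unfold wt
  rw [← Equiv.sum_comp (Equiv.mulLeft (Equiv.swap b c)), Finset.mul_sum]
  apply Finset.sum_congr rfl
  intro π _
  rw [show (Equiv.mulLeft (Equiv.swap b c)) π = Equiv.swap b c * π from rfl]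
  have e1 : evE n s t g (Equiv.swap b c * π) ↔ evE n s t g π := by
    constructor
    · intro h
      have := evE_swap n s t g hgU _ b c hb hc h
      simpa [← mul_assoc] using this
    · exact evE_swap n s t g hgU _ b c hb hc
  have e2 : (Equiv.swap b c * π) s = c ↔ π s = b := by
    rw [Equiv.Perm.mul_apply]
    constructor
    · intro h
      apply (Equiv.swap b c).injective
      rw [h]; simp
    · intro h; rw [h]; simp
  by_cases h : π s = b ∧ evE n s t g π
  · rw [if_pos h, if_pos ⟨e2.2 h.1, e1.2 h.2⟩]
    obtain ⟨hs, hE⟩ := h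
    have hm := mem_setB_iff n s t g hgU π hE
    have hb' : t ≤ b := by simp only [setB, Finset.mem_filter] at hb; exact hb.2.1
    have ha : s ≤ π.symm c := by
      have := hm (π.symm c)
      rw [Equiv.apply_symm_apply] at this
      exact (this.1 hc).2
    have hne : s ≠ π.symm c := by
      intro h
      have : π s = c := by rw [h]; simp
      rw [hs] at this
      exact hbc.ne this
    rw [inv_step n π s (π.symm c) b c (lt_of_le_of_ne ha hne) hs (by simp) hbc]
    · rw [pow_succ, mul_comm]
    · intro x h1 h2
      by_contra hx
      exact hbet (π x) ((hm x).2 ⟨hb'.trans h1.le, not_lt.mp hx⟩) h1 h2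
  · rw [if_neg h, if_neg (fun k => h ⟨e2.1 k.1, e1.1 k.2⟩), mul_zero]

theorem wt_eq (n : ℕ) (q : ℝ) (s t : Fin n) (g : Finset (Fin n × Fin n))
    (hgU : ∀ p ∈ g, p.1 < s ∨ p.2 < t) (ht : t ∈ setB n t g) (c : Fin n)
    (hc : c ∈ setB n t g) :
    wt n q s t g c = q ^ ((setB n t g).filter (· < c)).card * wt n q s t g t := by
  induction c using WellFoundedLT.induction with
  | ind c ih =>
  by_cases hct : c = t
  · subst hct
    have : (setB n c g).filter (· < c) = ∅ := by
      ext x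
      simp only [setB, Finset.mem_filter]
      grind
    simp [this]
  have htc : t < c := by
    simp only [setB, Finset.mem_filter] at hc
    exact lt_of_le_of_ne hc.2.1 (Ne.symm hct)
  have hne : ((setB n t g).filter (· < c)).Nonempty := ⟨t, by simp [ht, htc]⟩
  obtain ⟨b, hbm, hmax⟩ := Finset.exists_max_image _ id hne
  rw [Finset.mem_filter] at hbm
  have hbet : ∀ y ∈ setB n t g, b < y → ¬ y < c := by
    intro y hy h1 h2
    exact absurd (hmax y (by simp [hy, h2])) (not_le.mpr h1)
  rw [wt_step n q s t g hgU b c hbm.1 hc hbm.2 hbet, ih b hbm.2 hbm.1, ← mul_assoc, ← pow_succ']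
  congr 2
  rw [← Finset.card_insert_of_notMem (a := b) (by simp)]
  congr 1
  ext x
  have := hbet x
  simp only [Finset.mem_filter, Finset.mem_insert]
  grind

theorem card_setB (n : ℕ) (s t : Fin n) (g : Finset (Fin n × Fin n))
    (hgU : ∀ p ∈ g, p.1 < s ∨ p.2 < t) (π : Equiv.Perm (Fin n)) (h : evE n s t g π) :
    (setB n t g).card = n - g.card := by
  have hm := mem_setB_iff n s t g hgU π h
  have h' := (evE_iff n s t g hgU π).1 h
  have : g.card = (setB n t g)ᶜ.card := by
    apply Finset.card_nbij' (fun p => p.2) (fun y => (π.symm y, y))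
    · rintro ⟨x, y⟩ hp
      simp only [setB, Finset.coe_compl, Finset.coe_filter, Finset.mem_univ, true_and,
        Set.mem_compl_iff, Set.mem_ofPred_eq]
      intro hh
      exact hh.2 x hp
    · intro y hy
      have hy' : y ∉ setB n t g := by simpa using hy
      have := hm (π.symm y)
      rw [Equiv.apply_symm_apply] at this
      rw [this] at hy'
      exact (h' (π.symm y) y (by grind)).1 (by simp)
    · rintro ⟨x, y⟩ hp
      have := (h' x y (hgU _ hp)).2 hp
      simp [← this]
    · intro y _; rfl
  rw [this, Finset.card_compl, Fintype.card_fin]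
  have := Finset.card_le_univ (setB n t g)
  rw [Fintype.card_fin] at this
  omega

theorem total_wt (n : ℕ) (q : ℝ) (s t : Fin n) (g : Finset (Fin n × Fin n))
    (hgU : ∀ p ∈ g, p.1 < s ∨ p.2 < t) (hs : ¬ (∃ p ∈ g, p.1 = s ∧ p.2 < t)) :
    (∑ π : Equiv.Perm (Fin n), if evE n s t g π then q ^ invCount n π else 0)
      = ∑ b ∈ setB n t g, wt n q s t g b := by
  unfold wt
  rw [Finset.sum_comm]
  apply Finset.sum_congr rfl
  intro π _
  by_cases h : evE n s t g π
  · have hm : π s ∈ setB n t g := by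
      rw [mem_setB_iff n s t g hgU π h]
      refine ⟨?_, le_rfl⟩
      by_contra hlt
      have hlt := not_le.mp hlt
      exact hs ⟨(s, π s), ((evE_iff n s t g hgU π).1 h s (π s) (Or.inr hlt)).1 rfl, rfl, hlt⟩
    simp [h, hm]
  · simp [h]

theorem mProb_eq (n : ℕ) (q : ℝ) (A : Equiv.Perm (Fin n) → Prop) :
    mProb n q A = (∑ π : Equiv.Perm (Fin n), if A π then q ^ invCount n π else 0) / mallowsZ n q := by
  unfold mProb mallowsP
  rw [Finset.sum_div]
  apply Finset.sum_congr rfl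
  intro π _
  split_ifs <;> simp

theorem mallows_atomic_exposure
    (n : ℕ) (q : ℝ) (h0 : 0 < q) (h1 : q < 1) (s t : Fin n)
    (g : Finset (Fin n × Fin n))
    (hgU : ∀ p ∈ g, p.1 < s ∨ p.2 < t)
    (hpos : 0 < mProb n q (fun π =>
      graphP n π ∩
        Finset.univ.filter (fun p : Fin n × Fin n => p.1 < s ∨ p.2 < t) = g)) :
    ((¬ (∃ p ∈ g, p.1 < s ∧ p.2 = t) ∧ ¬ (∃ p ∈ g, p.1 = s ∧ p.2 < t)) →
      mCondProb n q (fun π => π s = t)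
          (fun π => graphP n π ∩
            Finset.univ.filter (fun p : Fin n × Fin n => p.1 < s ∨ p.2 < t) = g)
        = (1 - q) / (1 - q ^ (n - g.card))) ∧
    (((∃ p ∈ g, p.1 < s ∧ p.2 = t) ∨ (∃ p ∈ g, p.1 = s ∧ p.2 < t)) →
      mCondProb n q (fun π => π s = t)
          (fun π => graphP n π ∩
            Finset.univ.filter (fun p : Fin n × Fin n => p.1 < s ∨ p.2 < t) = g)
        = 0) := by
  change 0 < mProb n q (evE n s t g) at hpos
  change (_ → mCondProb n q (fun π => π s = t) (evE n s t g) = _) ∧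
    (_ → mCondProb n q (fun π => π s = t) (evE n s t g) = _)
  constructor
  · rintro ⟨ht, hs⟩
    have htB : t ∈ setB n t g := by
      simp only [setB, Finset.mem_filter, Finset.mem_univ, true_and]
      refine ⟨le_rfl, fun x hx => ht ⟨(x, t), hx, ?_, rfl⟩⟩
      have := hgU _ hx
      simpa using this
    obtain ⟨π, hπ⟩ : ∃ π, evE n s t g π := by
      by_contra hne
      push Not at hne
      simp [mProb, hne] at hpos
    have hcard := card_setB n s t g hgU π hπ
    have htot := total_wt n q s t g hgU hs
    rw [Finset.sum_congr rfl (fun b hb => wt_eq n q s t g hgU htB b hb), ← Finset.sum_mul,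
      sum_rank, hcard] at htot
    have hcpos : n - g.card ≠ 0 := by
      rw [← hcard]
      exact Finset.card_ne_zero_of_mem htB
    rw [mProb_eq, htot] at hpos
    unfold mCondProb
    have hnum : mProb n q (fun π => (fun π : Equiv.Perm (Fin n) => π s = t) π ∧ evE n s t g π)
        = wt n q s t g t / mallowsZ n q := by
      rw [mProb_eq]
      unfold wt
      congr 1
      apply Finset.sum_congr rfl
      intro π _
      congr
    rw [hnum, mProb_eq, htot]
    have hZ : mallowsZ n q ≠ 0 := by
      intro h; rw [h] at hpos; simp at hpos
    have hW : wt n q s t g t ≠ 0 := by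
      intro h; rw [h] at hpos; simp at hpos
    have hgeo := mul_neg_geom_sum q (n - g.card)
    have hlt : q ^ (n - g.card) < 1 := pow_lt_one₀ h0.le h1 hcpos
    have hS : (∑ i ∈ Finset.range (n - g.card), q ^ i) ≠ 0 := by
      intro h; rw [h] at hpos; simp at hpos
    rw [div_div_div_cancel_right₀ hZ, div_eq_div_iff (mul_ne_zero hS hW) (by linarith), ← hgeo]
    ring
  · intro h
    unfold mCondProb
    have : ∀ π, ¬ (π s = t ∧ evE n s t g π) := by
      rintro π ⟨h2, h3⟩
      rw [evE_iff n s t g hgU] at h3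
      rcases h with ⟨⟨x, y⟩, hp, hx, hy⟩ | ⟨⟨x, y⟩, hp, hx, hy⟩
      · have := (h3 x y (Or.inl hx)).2 hp
        have := π.injective (this.trans (hy.trans h2.symm))
        exact hx.ne this
      · have := (h3 x y (Or.inr hy)).2 hp
        simp only at hx hy
        rw [hx, h2] at this
        exact hy.ne this.symm
    simp [mProb, this]
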